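/- arXiv:1909.01260 — 4 statements merged into one kernel-verified Lean document; each statement's English description precedes it below -/
import Mathlib

section
/- Let G₁₅′ be the 6-regular simple graph on vertex set {0,1,...,11} with edges given by the adjacency lists: 0 ~ 1,2,3,4,5,11; 1 ~ 0,2,4,6,9,11; 2 ~ 0,1,3,6,7,11; 3 ~ 0,2,4,7,8,11; 4 ~ 0,1,3,8,9,11; 5 ~ 0,6,7,8,9,10; 6 ~ 1,2,5,7,9,10; 7 ~ 2,3,5,6,8,10; 8 ~ 3,4,5,7,9,10; 9 ~ 1,4,5,6,8,10; 10 ~ 5,6,7,8,9,11; 11 ~ 0,1,2,3,4,10. Then G₁₅′ is 6-list-edge-colorable. -/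
/-- `G` is `k`-list-edge-colorable: for every assignment of a finite list of at
least `k` colors to each edge there is a proper edge coloring choosing each
edge's color from its list. -/
def ListEdgeColorable {V : Type} (G : SimpleGraph V) (k : ℕ) : Prop :=
  ∀ (α : Type) (L : Sym2 V → Finset α), (∀ e ∈ G.edgeSet, k ≤ (L e).card) →
    ∃ c : Sym2 V → α, (∀ e ∈ G.edgeSet, c e ∈ L e) ∧
      ∀ e₁ ∈ G.edgeSet, ∀ e₂ ∈ G.edgeSet, e₁ ≠ e₂ → (∃ v, v ∈ e₁ ∧ v ∈ e₂) →
        c e₁ ≠ c e₂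

/-- The 6-regular graph `G₁₅′` on 12 vertices. -/
def G15' : SimpleGraph (Fin 12) :=
  SimpleGraph.fromEdgeSet
    {s(0, 1), s(0, 2), s(0, 3), s(0, 4), s(0, 5), s(0, 11), s(1, 2), s(1, 4), s(1, 6), s(1, 9), s(1, 11), s(2, 3), s(2, 6), s(2, 7), s(2, 11), s(3, 4), s(3, 7), s(3, 8), s(3, 11), s(4, 8), s(4, 9), s(4, 11), s(5, 6), s(5, 7), s(5, 8), s(5, 9), s(5, 10), s(6, 7), s(6, 9), s(6, 10), s(7, 8), s(7, 10), s(8, 9), s(8, 10), s(9, 10), s(10, 11)}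

theorem coeff_eq_sum_eval_mul_nodalWeight {F ι κ : Type*} [Field F] [Fintype ι] [DecidableEq ι]
    [Fintype κ] [DecidableEq κ] [Nonempty κ] (x : ι → κ → F) (hx : ∀ i, Function.Injective (x i))
    (P : MvPolynomial ι F) (hP : P.totalDegree ≤ Fintype.card ι * (Fintype.card κ - 1)) :
    P.coeff (Finsupp.equivFunOnFinite.symm fun _ => Fintype.card κ - 1) =
      ∑ c : ι → κ, P.eval (fun i => x i (c i)) *
        ∏ i, Lagrange.nodalWeight Finset.univ (x i) (c i) := by
  have key : ∀ i (m : ℕ), m ≤ Fintype.card κ - 1 →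
      ∑ k, x i k ^ m * Lagrange.nodalWeight Finset.univ (x i) k =
        if m = Fintype.card κ - 1 then 1 else 0 := by
    intro i m hm
    have hpos : 0 < Fintype.card κ := Fintype.card_pos
    have h := Lagrange.coeff_eq_sum (s := Finset.univ) (v := x i) (P := Polynomial.X ^ m)
      (hx i).injOn (by
        rw [Polynomial.degree_X_pow]
        exact_mod_cast (show m < (Finset.univ : Finset κ).card by rw [Finset.card_univ]; omega))
    rw [Polynomial.coeff_X_pow, Finset.card_univ] at h
    rw [eq_comm, if_congr eq_comm rfl rfl, h]
    refine Finset.sum_congr rfl fun k _ => ?_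
    simp [Lagrange.nodalWeight, div_eq_mul_inv, Finset.prod_inv_distrib]
  set t : ι →₀ ℕ := Finsupp.equivFunOnFinite.symm fun _ => Fintype.card κ - 1 with ht
  have mono : ∀ m ∈ P.support, ∏ i, ∑ k, x i k ^ m i * Lagrange.nodalWeight Finset.univ (x i) k =
      if m = t then 1 else 0 := by
    intro m hm
    split_ifs with h
    · refine Finset.prod_eq_one fun i _ => ?_
      rw [key i _ (by simp [h, ht]), if_pos (by simp [h, ht])]
    · obtain ⟨i, hi⟩ : ∃ i, m i < Fintype.card κ - 1 := by
        by_contra! hcon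
        refine h (Finsupp.ext fun i => ?_)
        have hdeg := (MvPolynomial.le_totalDegree hm).trans hP
        rw [Finsupp.sum_fintype _ _ fun _ => rfl] at hdeg
        have heq : ∑ _i : ι, (Fintype.card κ - 1) = ∑ i, m i :=
          le_antisymm (Finset.sum_le_sum fun i _ => hcon i) (by simpa using hdeg)
        exact ((Finset.sum_eq_sum_iff_of_le fun i _ => hcon i).1 heq i (Finset.mem_univ i)).symm
      refine Finset.prod_eq_zero (Finset.mem_univ i) ?_
      rw [key i _ hi.le, if_neg hi.ne]
  simp_rw [MvPolynomial.eval_eq', Finset.sum_mul]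
  rw [Finset.sum_comm]
  calc P.coeff t = ∑ m ∈ P.support, P.coeff m * if m = t then 1 else 0 := by
        simp +contextual
    _ = _ := Finset.sum_congr rfl fun m hm => by
        rw [← mono m hm, Finset.prod_univ_sum, Fintype.piFinset_univ, Finset.mul_sum]
        simp_rw [Finset.prod_mul_distrib, mul_assoc]

/-- The sign contributed by an ordered pair of colors: `-1` if they are in increasing order, `1` if
they are in decreasing order, and `0` if they are equal. -/
def colorSign {d : ℕ} (k c : Fin d) : ℤ := if k < c then -1 else if c < k then 1 else 0

/-- The signed indicator of injectivity of a sequence of `d` colors. -/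
def starSign {d : ℕ} (f : Fin d → Fin d) : ℤ := ∏ b, ∏ a ∈ Finset.Iio b, colorSign (f a) (f b)

theorem colorSign_swap {d : ℕ} (k c : Fin d) : colorSign k c = -colorSign c k := by
  unfold colorSign
  split_ifs <;> first | rfl | (exfalso; order)

theorem prod_Iio_eq_zero_of_not_injective {d : ℕ} {R α : Type*} [CommRing R]
    (f : Fin d → α) (hf : ¬ Function.Injective f) (h : α → α → R)
    (hh : ∀ a, h a a = 0) : ∏ b, ∏ a ∈ Finset.Iio b, h (f a) (f b) = 0 := by
  obtain ⟨a, b, hab, hne⟩ := Function.not_injective_iff.1 hf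
  wlog hlt : a < b generalizing a b
  · exact this b a hab.symm hne.symm (lt_of_le_of_ne (not_lt.1 hlt) hne.symm)
  refine Finset.prod_eq_zero (Finset.mem_univ b)
    (Finset.prod_eq_zero (Finset.mem_Iio.2 hlt) ?_)
  rw [hab, hh]

theorem starSign_comp {d : ℕ} (σ : Equiv.Perm (Fin d)) (f : Fin d → Fin d) :
    starSign (σ ∘ f) = σ.sign * starSign f := by
  by_cases hf : Function.Injective f
  · obtain ⟨τ, rfl⟩ : ∃ τ : Equiv.Perm (Fin d), f = τ :=
      ⟨Equiv.ofBijective f (Finite.injective_iff_bijective.1 hf), rfl⟩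
    have h := fun π : Equiv.Perm (Fin d) => π.prod_Iio_comp_eq_sign_mul_prod
      (f := fun i j => colorSign i j) colorSign_swap
    have h1 := h (σ * τ)
    have h2 := h τ
    simp only [starSign, Function.comp_apply] at h1 h2 ⊢
    rw [h2]
    simp only [Equiv.Perm.coe_mul, Function.comp_apply] at h1
    rw [h1]
    simp [mul_assoc]
  · have hself : ∀ a : Fin d, colorSign a a = 0 := fun a => by simp [colorSign]
    have h1 := prod_Iio_eq_zero_of_not_injective f hf colorSign hself
    have h2 := prod_Iio_eq_zero_of_not_injective (σ ∘ f)
      (fun h => hf (Function.Injective.of_comp h)) colorSign hself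
    unfold starSign
    rw [h1, h2, mul_zero]

theorem starSign_id_sq (d : ℕ) :
    starSign (id : Fin d → Fin d) * starSign (id : Fin d → Fin d) = 1 := by
  unfold starSign
  rw [← Finset.prod_mul_distrib]
  refine Finset.prod_eq_one fun b _ => ?_
  rw [← Finset.prod_mul_distrib]
  refine Finset.prod_eq_one fun a ha => ?_
  simp [colorSign, Finset.mem_Iio.1 ha]

theorem prod_Iio_sub_mul_prod {d : ℕ} {R : Type*} [CommRing R] (x u : Fin d → R)
    (f : Fin d → Fin d) :
    (∏ b, ∏ a ∈ Finset.Iio b, (x (f a) - x (f b))) * ∏ a, u (f a) = starSign f *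
      (starSign (id : Fin d → Fin d) * (∏ b, ∏ a ∈ Finset.Iio b, (x a - x b)) * ∏ a, u a) := by
  by_cases hf : Function.Injective f
  · obtain ⟨τ, rfl⟩ : ∃ τ : Equiv.Perm (Fin d), f = τ :=
      ⟨Equiv.ofBijective f (Finite.injective_iff_bijective.1 hf), rfl⟩
    rw [τ.prod_Iio_comp_eq_sign_mul_prod (f := fun i j => x i - x j) fun i j => by ring,
      Equiv.prod_comp τ u]
    have h := starSign_comp τ id
    rw [Function.comp_id] at h
    have h2 := congrArg (Int.cast : ℤ → R) (starSign_id_sq d)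
    push_cast at h2
    rw [h]
    push_cast
    linear_combination (-(((τ.sign : ℤ) : R) *
      (∏ b, ∏ a ∈ Finset.Iio b, (x a - x b)) * ∏ a, u a)) * h2
  · have h1 := prod_Iio_eq_zero_of_not_injective f hf colorSign fun a => by simp [colorSign]
    have h2 := prod_Iio_eq_zero_of_not_injective f hf (fun i j => x i - x j) fun a => by simp
    rw [h2, starSign, h1]
    simp

theorem prod_prod_comp_of_card_fiber_eq {V ι J M : Type*} [Fintype V] [Fintype ι] [Fintype J]
    [DecidableEq ι] [CommMonoid M] {k : ℕ} (g : V → J → ι)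
    (hg : ∀ e, (Finset.univ.filter fun p : V × J => g p.1 p.2 = e).card = k) (h : ι → M) :
    ∏ v, ∏ a, h (g v a) = ∏ i, h i ^ k := by
  rw [← Fintype.prod_prod_type' (f := fun v a => h (g v a)),
    ← Finset.prod_fiberwise' Finset.univ (fun p : V × J => g p.1 p.2) h]
  refine Finset.prod_congr rfl fun i _ => ?_
  rw [Finset.prod_const, hg]

/-- The product of the Vandermonde polynomials of the stars listed by `g`. -/
noncomputable def starPolynomial {V ι : Type*} [Fintype V] {d : ℕ} (g : V → Fin d → ι) :
    MvPolynomial ι ℂ :=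
  ∏ v, ∏ b, ∏ a ∈ Finset.Iio b, (MvPolynomial.X (g v a) - MvPolynomial.X (g v b))

theorem totalDegree_starPolynomial_le {V ι : Type*} [Fintype V] [Fintype ι] [DecidableEq ι] {d : ℕ}
    (g : V → Fin d → ι)
    (hg : ∀ e, (Finset.univ.filter fun p : V × Fin d => g p.1 p.2 = e).card = 2) :
    (starPolynomial g).totalDegree ≤ Fintype.card ι * (d - 1) := by
  have hcard : Fintype.card V * d = Fintype.card ι * 2 := by
    have h := Finset.card_eq_sum_card_fiberwise (s := (Finset.univ : Finset (V × Fin d)))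
      (t := Finset.univ) (f := fun p => g p.1 p.2) fun _ _ => Finset.mem_coe.2 (Finset.mem_univ _)
    simpa [hg] using h
  have hstar : ∑ b : Fin d, (Finset.Iio b).card = ∑ i ∈ Finset.range d, i := by
    simp [Fin.card_Iio, Fin.sum_univ_eq_sum_range fun i => i]
  have hle : (starPolynomial g).totalDegree ≤ ∑ _v : V, ∑ b : Fin d, (Finset.Iio b).card := by
    refine (MvPolynomial.totalDegree_finsetProd _ _).trans (Finset.sum_le_sum fun v _ => ?_)
    refine (MvPolynomial.totalDegree_finsetProd _ _).trans (Finset.sum_le_sum fun b _ => ?_)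
    refine (MvPolynomial.totalDegree_finsetProd _ _).trans ?_
    rw [Finset.card_eq_sum_ones]
    refine Finset.sum_le_sum fun a _ => ?_
    refine (MvPolynomial.totalDegree_sub _ _).trans ?_
    simp
  refine hle.trans ?_
  rw [hstar, Finset.sum_const, Finset.card_univ, smul_eq_mul]
  have h2 := Finset.sum_range_id_mul_two d
  refine le_of_mul_le_mul_right (a := 2) ?_ two_pos
  rw [mul_assoc, h2, ← mul_assoc, hcard]
  exact le_of_eq (by ring)

theorem exists_forall_injective_of_sum_starSign_ne_zero {V ι α : Type*} [Fintype V] [Fintype ι]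
    [DecidableEq ι] {d : ℕ} [NeZero d] (g : V → Fin d → ι)
    (hg : ∀ e, (Finset.univ.filter fun p : V × Fin d => g p.1 p.2 = e).card = 2)
    (hsum : ∑ c : ι → Fin d, ∏ v, starSign (c ∘ g v) ≠ 0)
    (x : ι → Fin d → α) (hx : ∀ i, Function.Injective (x i)) :
    ∃ c : ι → Fin d, ∀ v, Function.Injective fun j => x (g v j) (c (g v j)) := by
  have hcoeff : (starPolynomial g).coeff
      (Finsupp.equivFunOnFinite.symm fun _ => Fintype.card (Fin d) - 1) ≠ 0 := by
    set y : Fin d → ℂ := fun k => ((k : ℕ) : ℂ) with hy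
    have hinj : Function.Injective y := Nat.cast_injective.comp Fin.val_injective
    rw [coeff_eq_sum_eval_mul_nodalWeight (fun _ => y) (fun _ => hinj) _
      (by simpa using totalDegree_starPolynomial_le g hg)]
    choose u hu using fun k => IsAlgClosed.exists_pow_nat_eq
      (Lagrange.nodalWeight Finset.univ y k) two_pos
    set K : ℂ := starSign (id : Fin d → Fin d) *
      (∏ b, ∏ a ∈ Finset.Iio b, (y a - y b)) * ∏ a, u a with hK
    have hu0 : ∀ k, u k ≠ 0 := fun k h => by
      have := hu k
      rw [h, zero_pow two_ne_zero] at this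
      exact Lagrange.nodalWeight_ne_zero hinj.injOn (Finset.mem_univ k) this.symm
    have hK0 : K ≠ 0 := by
      refine mul_ne_zero (mul_ne_zero ?_ ?_) (Finset.prod_ne_zero_iff.2 fun a _ => hu0 a)
      · exact_mod_cast left_ne_zero_of_mul_eq_one (starSign_id_sq d)
      · refine Finset.prod_ne_zero_iff.2 fun b _ => Finset.prod_ne_zero_iff.2 fun a ha => ?_
        exact sub_ne_zero.2 (hinj.ne (Finset.mem_Iio.1 ha).ne)
    have hterm : ∀ c : ι → Fin d, (starPolynomial g).eval (fun i => y (c i)) *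
        ∏ i, Lagrange.nodalWeight Finset.univ y (c i) =
        ((∏ v, starSign (c ∘ g v) : ℤ) : ℂ) * K ^ Fintype.card V := by
      intro c
      have hw : ∏ i, Lagrange.nodalWeight Finset.univ y (c i) = ∏ v, ∏ a, u (c (g v a)) := by
        rw [prod_prod_comp_of_card_fiber_eq g hg fun i => u (c i)]
        exact Finset.prod_congr rfl fun i _ => (hu _).symm
      rw [hw, starPolynomial]
      simp only [map_prod, map_sub, MvPolynomial.eval_X]
      rw [← Finset.prod_mul_distrib, Int.cast_prod, ← Finset.card_univ, ← Finset.prod_const,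
        ← Finset.prod_mul_distrib]
      exact Finset.prod_congr rfl fun v _ => prod_Iio_sub_mul_prod y u (c ∘ g v)
    rw [Finset.sum_congr rfl fun c _ => hterm c, ← Finset.sum_mul]
    exact mul_ne_zero (by exact_mod_cast hsum) (pow_ne_zero _ hK0)
  obtain ⟨φ, hφ⟩ := Set.countable_iff_exists_injOn.1
    (Set.finite_range fun p : ι × Fin d => x p.1 p.2).countable
  have hmem : ∀ i k, x i k ∈ Set.range fun p : ι × Fin d => x p.1 p.2 := fun i k => ⟨(i, k), rfl⟩
  rw [coeff_eq_sum_eval_mul_nodalWeight (fun i k => ((φ (x i k) : ℕ) : ℂ))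
    (fun i k l h => hx i (hφ (hmem i k) (hmem i l) (Nat.cast_injective h))) _
    (by simpa using totalDegree_starPolynomial_le g hg)] at hcoeff
  obtain ⟨c, -, hc⟩ := Finset.exists_ne_zero_of_sum_ne_zero hcoeff
  refine ⟨c, fun v => by_contra fun hv => left_ne_zero_of_mul hc ?_⟩
  rw [starPolynomial]
  simp only [map_prod, map_sub, MvPolynomial.eval_X]
  exact Finset.prod_eq_zero (Finset.mem_univ v) (prod_Iio_eq_zero_of_not_injective
    (fun j => x (g v j) (c (g v j))) hv (fun s t => ((φ s : ℕ) : ℂ) - (φ t : ℕ)) (by simp))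

theorem sum_starSign_eq_factorial_mul {V ι : Type*} [Fintype V] [Fintype ι] [DecidableEq ι] {d : ℕ}
    (g : V → Fin d → ι) (hV : Even (Fintype.card V)) (v₀ : V) :
    ∑ c : ι → Fin d, ∏ v, starSign (c ∘ g v) =
      d.factorial * ∑ c : ι → Fin d, if c ∘ g v₀ = id then ∏ v, starSign (c ∘ g v) else 0 := by
  have hσ : ∀ (σ : Equiv.Perm (Fin d)) (c : ι → Fin d),
      ∏ v, starSign ((σ ∘ c) ∘ g v) = ∏ v, starSign (c ∘ g v) := by
    intro σ c
    simp_rw [Function.comp_assoc, starSign_comp, Finset.prod_mul_distrib, Finset.prod_const,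
      Finset.card_univ]
    obtain ⟨m, hm⟩ := hV
    rw [hm, pow_add, ← mul_pow, ← Units.val_mul, Int.units_mul_self, Units.val_one, one_pow,
      one_mul]
  have hsplit : ∀ c : ι → Fin d, ∏ v, starSign (c ∘ g v) =
      ∑ σ : Equiv.Perm (Fin d), if c ∘ g v₀ = σ then ∏ v, starSign (c ∘ g v) else 0 := by
    intro c
    by_cases hc : Function.Injective (c ∘ g v₀)
    · obtain ⟨τ, hτ⟩ : ∃ τ : Equiv.Perm (Fin d), c ∘ g v₀ = τ :=
        ⟨Equiv.ofBijective _ (Finite.injective_iff_bijective.1 hc), rfl⟩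
      simp [hτ]
    · have h0 : ∏ v, starSign (c ∘ g v) = 0 := Finset.prod_eq_zero (Finset.mem_univ v₀)
        (prod_Iio_eq_zero_of_not_injective (c ∘ g v₀) hc colorSign fun a => by simp [colorSign])
      simp [h0]
  rw [Finset.sum_congr rfl fun c _ => hsplit c, Finset.sum_comm]
  have hfib : ∀ σ : Equiv.Perm (Fin d),
      (∑ c : ι → Fin d, if c ∘ g v₀ = σ then ∏ v, starSign (c ∘ g v) else 0) =
      ∑ c : ι → Fin d, if c ∘ g v₀ = id then ∏ v, starSign (c ∘ g v) else 0 := by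
    intro σ
    refine (Fintype.sum_equiv ((Equiv.refl ι).arrowCongr σ) _ _ fun c => ?_).symm
    have hc : ((Equiv.refl ι).arrowCongr σ) c = σ ∘ c := rfl
    have hiff : (σ ∘ c) ∘ g v₀ = σ ↔ c ∘ g v₀ = id := by
      rw [Function.comp_assoc]
      exact ⟨fun h => funext fun a => σ.injective (congrFun h a), fun h => by rw [h]; rfl⟩
    rw [hc, hσ, if_congr hiff rfl rfl]
  rw [Finset.sum_congr rfl fun σ _ => hfib σ, Finset.sum_const, Finset.card_univ,
    Fintype.card_perm, Fintype.card_fin, nsmul_eq_mul]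

/-- Evaluates `x` to a numeral before passing it to `K`, so that kernel evaluation can recognize
that `K` has already been evaluated at the same argument. -/
def force (x : ℕ) (K : ℕ → ℕ) : ℕ := Nat.rec (K 0) (fun n _ => K (Nat.succ n)) x

/-- The residue modulo `7` of `-1` to the number of binary digits `1` of `x < 32`. -/
def paritySign (x : ℕ) : ℕ :=
  Nat.add 1 (Nat.mul 5 (Nat.land 1 (Nat.shiftRight 2523490710 x)))

/-- The contribution of giving color `k` to an edge with ends `a` and `b`. -/
def colorContribution (K : ℕ → ℕ) (a b S x f k : ℕ) : ℕ :=
  Nat.rec 0 (fun _ _ => Nat.mul (paritySign (Nat.land x (Nat.sub (Nat.shiftLeft 1 k) 1)))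
    (force (Nat.xor S (Nat.xor (Nat.shiftLeft 1 (Nat.add (Nat.mul 6 a) k))
      (Nat.shiftLeft 1 (Nat.add (Nat.mul 6 b) k)))) K)) (Nat.land f (Nat.shiftLeft 1 k))

/-- The sum of the contributions of the six colors. -/
def colorSum (K : ℕ → ℕ) (a b S x f : ℕ) : ℕ :=
  Nat.add (colorContribution K a b S x f 0) (Nat.add (colorContribution K a b S x f 1)
    (Nat.add (colorContribution K a b S x f 2) (Nat.add (colorContribution K a b S x f 3)
      (Nat.add (colorContribution K a b S x f 4) (colorContribution K a b S x f 5)))))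

/-- The residue modulo `7` of the sum over the colors of an edge. -/
def edgeSum (a b m : ℕ) (K : ℕ → ℕ) (S : ℕ) : ℕ :=
  Nat.mod (colorSum K a b S
    (Nat.xor (Nat.shiftRight S (Nat.mul 6 a)) (Nat.shiftRight S (Nat.mul 6 b)))
    (Nat.land m (Nat.land (Nat.shiftRight S (Nat.mul 6 a)) (Nat.shiftRight S (Nat.mul 6 b))))) 7

/-- The residue modulo `7` of the signed sum of the proper edge colorings of the edges `es` that
extend a partial coloring. An edge `(a, b, m)` has ends `a` and `b`, and the digit `k` of `m` tells
whether color `k` is allowed; the digit `6 * w + k` of the state tells whether color `k` is still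
free at the vertex `w`. -/
def signedSum (es : List (ℕ × ℕ × ℕ)) : ℕ → ℕ :=
  List.rec (fun _ => 1) (fun e _ K => edgeSum e.1 e.2.1 e.2.2 K) es

/-- The sign of adding color `k` at the vertex `w` in the state `S`. -/
def freeSign (S w : ℕ) (k : Fin 6) : ℤ :=
  ∏ l : Fin 6, if S.testBit (6 * w + l) then 1 else colorSign l k

theorem force_eq (x : ℕ) (K : ℕ → ℕ) : force x K = K x := by
  cases x <;> rfl

theorem paritySign_land (x : ℕ) (k : Fin 6) :
    (paritySign (Nat.land x (Nat.sub (Nat.shiftLeft 1 k) 1)) : ZMod 7) =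
      ((∏ l : Fin 6, if l < k ∧ x.testBit l then -1 else 1 : ℤ) : ZMod 7) := by
  have hparity : ∀ y < 32, (paritySign y : ZMod 7) =
      ((∏ l : Fin 6, if y.testBit l then -1 else 1 : ℤ) : ZMod 7) := by decide +kernel
  have heq : Nat.land x (Nat.sub (Nat.shiftLeft 1 k) 1) = x &&& (2 ^ (k : ℕ) - 1) := by
    rw [← Nat.one_shiftLeft]; rfl
  have hle : 2 ^ (k : ℕ) ≤ 2 ^ 5 := Nat.pow_le_pow_right two_pos (by omega)
  rw [heq, hparity _ (lt_of_le_of_lt Nat.and_le_right (by omega))]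
  simp [and_comm]

theorem colorContribution_eq (K : ℕ → ℕ) (a b S m : ℕ) (k : Fin 6) :
    (colorContribution K a b S
      (Nat.xor (Nat.shiftRight S (Nat.mul 6 a)) (Nat.shiftRight S (Nat.mul 6 b)))
      (Nat.land m (Nat.land (Nat.shiftRight S (Nat.mul 6 a)) (Nat.shiftRight S (Nat.mul 6 b)))) k :
        ZMod 7) =
      ((if m.testBit k then freeSign S a k * freeSign S b k else 0 : ℤ) : ZMod 7) *
        K (S ^^^ (2 ^ (6 * a + k) ^^^ 2 ^ (6 * b + k))) := by
  have hx : ∀ l, (Nat.xor (Nat.shiftRight S (Nat.mul 6 a))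
      (Nat.shiftRight S (Nat.mul 6 b))).testBit l =
        (S.testBit (6 * a + l) ^^ S.testBit (6 * b + l)) := fun l => by
    change ((S >>> (6 * a)) ^^^ (S >>> (6 * b))).testBit l = _
    rw [Nat.testBit_xor, Nat.testBit_shiftRight, Nat.testBit_shiftRight]
  have hf : Nat.land (Nat.land m (Nat.land (Nat.shiftRight S (Nat.mul 6 a))
      (Nat.shiftRight S (Nat.mul 6 b)))) (Nat.shiftLeft 1 k) =
      (m.testBit k && (S.testBit (6 * a + k) && S.testBit (6 * b + k))).toNat * 2 ^ (k : ℕ) := by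
    change (m &&& ((S >>> (6 * a)) &&& (S >>> (6 * b)))) &&& (1 <<< (k : ℕ)) = _
    rw [Nat.one_shiftLeft, Nat.and_two_pow, Nat.testBit_and, Nat.testBit_and,
      Nat.testBit_shiftRight, Nat.testBit_shiftRight]
  have hS : Nat.xor S (Nat.xor (Nat.shiftLeft 1 (Nat.add (Nat.mul 6 a) k))
      (Nat.shiftLeft 1 (Nat.add (Nat.mul 6 b) k))) =
      S ^^^ (2 ^ (6 * a + k) ^^^ 2 ^ (6 * b + k)) := by
    rw [← Nat.one_shiftLeft, ← Nat.one_shiftLeft]; rfl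
  have hzero : ∀ w, S.testBit (6 * w + k) = false → freeSign S w k = 0 := fun w hw =>
    Finset.prod_eq_zero (Finset.mem_univ k) (by simp [hw, colorSign])
  unfold colorContribution
  rw [hf, hS, force_eq]
  by_cases hm : m.testBit k
  swap
  · simp [hm]
  by_cases ha : S.testBit (6 * a + k)
  swap
  · simp [ha, hzero a]
  by_cases hb : S.testBit (6 * b + k)
  swap
  · simp [hb, hzero b]
  obtain ⟨p, hp⟩ := Nat.exists_eq_succ_of_ne_zero (pow_ne_zero (k : ℕ) two_ne_zero)
  have hsign : freeSign S a k * freeSign S b k =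
      ∏ l : Fin 6, if l < k ∧ (S.testBit (6 * a + l) ^^ S.testBit (6 * b + l)) then -1 else 1 := by
    unfold freeSign
    rw [← Finset.prod_mul_distrib]
    refine Finset.prod_congr rfl fun l _ => ?_
    rcases lt_trichotomy l k with h | rfl | h
    · cases S.testBit (6 * a + l) <;> cases S.testBit (6 * b + l) <;> simp [colorSign, h]
    · simp [ha, hb]
    · simp [colorSign, h, h.not_gt]
  simp only [hm, ha, hb, Bool.and_self, Bool.toNat_true, one_mul, if_true, hp]
  rw [hsign]
  simp only [← hx]
  rw [← paritySign_land]
  exact Nat.cast_mul _ _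

theorem edgeSum_eq (K : ℕ → ℕ) (a b S m : ℕ) :
    (edgeSum a b m K S : ZMod 7) = ∑ k : Fin 6,
      ((if m.testBit k then freeSign S a k * freeSign S b k else 0 : ℤ) : ZMod 7) *
        K (S ^^^ (2 ^ (6 * a + k) ^^^ 2 ^ (6 * b + k))) := by
  simp_rw [← colorContribution_eq, edgeSum]
  change ((_ % 7 : ℕ) : ZMod 7) = _
  rw [ZMod.natCast_mod, ← Nat.cast_sum, Fin.sum_univ_six]
  simp only [colorSum, Nat.add_eq, add_assoc]
  rfl

theorem freeSign_xor {a b S : ℕ} (hab : a ≠ b) {k : Fin 6} (ha : S.testBit (6 * a + k))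
    (hb : S.testBit (6 * b + k)) (w : ℕ) (c : Fin 6) :
    freeSign (S ^^^ (2 ^ (6 * a + k) ^^^ 2 ^ (6 * b + k))) w c =
      freeSign S w c * if w = a ∨ w = b then colorSign k c else 1 := by
  have h : (if w = a ∨ w = b then colorSign k c else 1) =
      ∏ l : Fin 6, if l = k then (if w = a ∨ w = b then colorSign k c else 1) else 1 := by simp
  rw [h, freeSign, freeSign, ← Finset.prod_mul_distrib]
  refine Finset.prod_congr rfl fun l _ => ?_
  have key : ∀ z, 6 * z + (k : ℕ) = 6 * w + l ↔ w = z ∧ l = k := fun z => by omega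
  simp only [Nat.testBit_xor, Nat.testBit_two_pow, key]
  by_cases hl : l = k
  · subst hl
    by_cases hwa : w = a
    · subst hwa; simp [hab, ha]
    · by_cases hwb : w = b
      · subst hwb; simp [hwa, hb]
      · simp [hwa, hwb]
  · simp [hl]

/-- The sign of a pair of edges of colors `k` and `c`, with one factor for each common end. -/
def pairSign (e f : ℕ × ℕ × ℕ) (k c : Fin 6) : ℤ :=
  (if f.1 = e.1 ∨ f.1 = e.2.1 then colorSign k c else 1) *
    if f.2.1 = e.1 ∨ f.2.1 = e.2.1 then colorSign k c else 1

theorem signedSum_ofFn {n : ℕ} (e : Fin n → ℕ × ℕ × ℕ) (he : ∀ i, (e i).1 ≠ (e i).2.1) (S : ℕ) :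
    (signedSum (List.ofFn e) S : ZMod 7) = ((∑ c : Fin n → Fin 6,
      (∏ j, if (e j).2.2.testBit (c j) then
        freeSign S (e j).1 (c j) * freeSign S (e j).2.1 (c j) else 0) *
      ∏ j, ∏ i, if i < j then pairSign (e i) (e j) (c i) (c j) else 1 : ℤ) : ZMod 7) := by
  induction n generalizing S with
  | zero => simp [signedSum]
  | succ n ih =>
    have hcons : signedSum (List.ofFn e) S = edgeSum (e 0).1 (e 0).2.1 (e 0).2.2
        (signedSum (List.ofFn fun i : Fin n => e i.succ)) S := by
      rw [List.ofFn_succ]; rfl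
    rw [hcons, edgeSum_eq, ← Equiv.sum_comp (Fin.consEquiv fun _ : Fin (n + 1) => Fin 6),
      Fintype.sum_prod_type, Int.cast_sum]
    refine Finset.sum_congr rfl fun k _ => ?_
    rw [ih _ fun i => he i.succ, ← Int.cast_mul, Finset.mul_sum]
    congr 1
    refine Finset.sum_congr rfl fun c _ => ?_
    simp only [Fin.consEquiv_apply, Fin.prod_univ_succ, Fin.cons_zero, Fin.cons_succ,
      Fin.succ_lt_succ_iff, Fin.succ_pos, not_lt_zero, if_true, if_false, lt_irrefl,
      Finset.prod_const_one, one_mul]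
    by_cases hm : (e 0).2.2.testBit k
    swap
    · simp [hm]
    have hzero : ∀ w, S.testBit (6 * w + k) = false → freeSign S w k = 0 := fun w hw =>
      Finset.prod_eq_zero (Finset.mem_univ k) (by simp [hw, colorSign])
    by_cases ha : S.testBit (6 * (e 0).1 + k)
    swap
    · simp [hzero _ (Bool.eq_false_of_not_eq_true ha)]
    by_cases hb : S.testBit (6 * (e 0).2.1 + k)
    swap
    · simp [hzero _ (Bool.eq_false_of_not_eq_true hb)]
    simp only [freeSign_xor (he 0) ha hb, Finset.prod_mul_distrib]
    have hsplit : ∀ j : Fin n, (if (e j.succ).2.2.testBit (c j) then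
        (freeSign S (e j.succ).1 (c j) *
          if (e j.succ).1 = (e 0).1 ∨ (e j.succ).1 = (e 0).2.1 then colorSign k (c j) else 1) *
        (freeSign S (e j.succ).2.1 (c j) *
          if (e j.succ).2.1 = (e 0).1 ∨ (e j.succ).2.1 = (e 0).2.1 then colorSign k (c j) else 1)
        else 0) = (if (e j.succ).2.2.testBit (c j) then
          freeSign S (e j.succ).1 (c j) * freeSign S (e j.succ).2.1 (c j) else 0) *
        pairSign (e 0) (e j.succ) k (c j) := fun j => by
      unfold pairSign
      by_cases h : (e j.succ).2.2.testBit (c j)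
      · simp only [h, if_true]; ring
      · simp [h]
    simp only [hsplit, Finset.prod_mul_distrib]
    ring

theorem prod_Iio_comp_strictMono {d n : ℕ} {R : Type*} [CommMonoid R] {h : Fin d → Fin n}
    (hh : StrictMono h) (F : Fin n → Fin n → R) :
    ∏ b, ∏ a ∈ Finset.Iio b, F (h a) (h b) = ∏ j, ∏ i, if i < j then
      (if (∃ a, h a = i) ∧ (∃ b, h b = j) then F i j else 1) else 1 := by
  classical
  refine Fintype.prod_of_injective h hh.injective _ _ (fun j hj => ?_) fun b => ?_
  · have hj' : ¬ ∃ b, h b = j := hj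
    simp [hj']
  · rw [show Finset.Iio b = Finset.univ.filter (· < b) by ext; simp, Finset.prod_filter]
    refine Fintype.prod_of_injective h hh.injective _ _ (fun i hi => ?_) fun a => ?_
    · have hi' : ¬ ∃ a, h a = i := hi
      simp [hi']
    · simp [hh.lt_iff_lt]

theorem prod_ite_and_eq {N : ℕ} (u v x y : Fin N) (hxy : x ≠ y) (z : ℤ) :
    (∏ w, if (w = u ∨ w = v) ∧ (w = x ∨ w = y) then z else 1) =
      (if x = u ∨ x = v then z else 1) * if y = u ∨ y = v then z else 1 := by
  have h : ∀ w, (if (w = u ∨ w = v) ∧ (w = x ∨ w = y) then z else 1) =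
      (if w = x then (if x = u ∨ x = v then z else 1) else 1) *
        if w = y then (if y = u ∨ y = v then z else 1) else 1 := by
    intro w
    by_cases hx : w = x
    · subst hx; simp [hxy]
    · by_cases hy : w = y
      · subst hy; simp [hx]
      · simp [hx, hy]
  simp_rw [h, Finset.prod_mul_distrib]
  simp

theorem signedSum_eq_sum_starSign {N n : ℕ} (p q : Fin n → Fin N) (hpq : ∀ i, p i ≠ q i)
    (m : Fin n → ℕ) (g : Fin N → Fin 6 → Fin n) (hmono : ∀ v, StrictMono (g v))
    (hg : ∀ v i, (∃ a, g v a = i) ↔ v = p i ∨ v = q i) (v₀ : Fin N)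
    (hm : ∀ c : Fin n → Fin 6, (∀ j, (m j).testBit (c j)) ↔ c ∘ g v₀ = id) :
    (signedSum (List.ofFn fun i => (p i, q i, m i)) (2 ^ (6 * N) - 1) : ZMod 7) =
      ((∑ c : Fin n → Fin 6, if c ∘ g v₀ = id then ∏ v, starSign (c ∘ g v) else 0 : ℤ) :
        ZMod 7) := by
  rw [signedSum_ofFn _ fun i h => hpq i (Fin.ext h)]
  congr 1
  refine Finset.sum_congr rfl fun c _ => ?_
  have hfree : ∀ (w : Fin N) k, freeSign (2 ^ (6 * N) - 1) w k = 1 := fun w k =>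
    Finset.prod_eq_one fun l _ => by
      rw [Nat.testBit_two_pow_sub_one, if_pos (decide_eq_true (by omega))]
  have hstar : ∏ v, starSign (c ∘ g v) = ∏ j, ∏ i, if i < j then
      pairSign (p i, q i, m i) (p j, q j, m j) (c i) (c j) else 1 := by
    unfold starSign
    simp only [Function.comp_apply]
    rw [Finset.prod_congr rfl fun v _ =>
      prod_Iio_comp_strictMono (hmono v) fun i j => colorSign (c i) (c j), Finset.prod_comm]
    refine Finset.prod_congr rfl fun j _ => ?_
    rw [Finset.prod_comm]
    refine Finset.prod_congr rfl fun i _ => ?_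
    by_cases hij : i < j
    · simp only [hij, if_true, hg, pairSign, Fin.val_inj]
      exact prod_ite_and_eq _ _ _ _ (hpq j) _
    · simp [hij]
  simp only [hfree, mul_one, Finset.prod_ite_zero, Finset.prod_const_one, Finset.mem_univ,
    true_implies, hm, ite_mul, one_mul, zero_mul, hstar]

/-- The edges of `G15'`, in an order that keeps the number of states met by `signedSum` small. Only
color `i` is allowed on the `i`-th of the six edges at the vertex `6`, which come first. -/
def edgeList : List (ℕ × ℕ × ℕ) :=
  [(6, 7, 1), (6, 9, 2), (6, 10, 4), (1, 6, 8), (5, 6, 16), (2, 6, 32),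
    (5, 7, 63), (7, 10, 63), (2, 7, 63), (7, 8, 63), (3, 7, 63), (5, 10, 63),
    (9, 10, 63), (8, 10, 63), (10, 11, 63), (5, 8, 63), (5, 9, 63), (0, 5, 63),
    (8, 9, 63), (1, 9, 63), (4, 9, 63), (4, 8, 63), (3, 8, 63), (2, 3, 63),
    (3, 4, 63), (3, 11, 63), (0, 3, 63), (0, 2, 63), (2, 11, 63), (1, 2, 63),
    (1, 4, 63), (0, 4, 63), (4, 11, 63), (0, 1, 63), (1, 11, 63), (0, 11, 63)]

/-- The first end of an edge. -/
def firstEnd (i : Fin 36) : Fin 12 := Fin.ofNat 12 (edgeList.getD i (0, 0, 0)).1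

/-- The second end of an edge. -/
def secondEnd (i : Fin 36) : Fin 12 := Fin.ofNat 12 (edgeList.getD i (0, 0, 0)).2.1

/-- The colors allowed on an edge, as binary digits. -/
def colorMask (i : Fin 36) : ℕ := (edgeList.getD i (0, 0, 0)).2.2

/-- The edges at each vertex, in increasing order. -/
def incidentEdge (v : Fin 12) (a : Fin 6) : Fin 36 :=
  ((List.finRange 36).filter fun i => v = firstEnd i ∨ v = secondEnd i).getD a 0

theorem edgeList_eq_ofFn : edgeList =
    List.ofFn fun i => ((firstEnd i : ℕ), (secondEnd i : ℕ), colorMask i) := by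
  decide +kernel

theorem incidentEdge_strictMono : ∀ v, StrictMono (incidentEdge v) := by
  unfold StrictMono
  decide +kernel

theorem exists_incidentEdge_eq_iff :
    ∀ v i, (∃ a, incidentEdge v a = i) ↔ v = firstEnd i ∨ v = secondEnd i := by
  decide +kernel

theorem card_incidentEdge_fiber : ∀ e, (Finset.univ.filter
    fun p : Fin 12 × Fin 6 => incidentEdge p.1 p.2 = e).card = 2 := by
  decide +kernel

theorem forall_colorMask_iff (c : Fin 36 → Fin 6) :
    (∀ j, (colorMask j).testBit (c j)) ↔ c ∘ incidentEdge 6 = id := by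
  have h1 : ∀ i k : Fin 6, (colorMask (incidentEdge 6 i)).testBit k → k = i := by decide +kernel
  have h2 : ∀ j, (∀ k : Fin 6, (colorMask j).testBit k) ∨
      ∃ i : Fin 6, incidentEdge 6 i = j ∧ (colorMask j).testBit i := by decide +kernel
  refine ⟨fun h => funext fun i => h1 i _ (h _), fun h j => ?_⟩
  rcases h2 j with hj | ⟨i, rfl, hi⟩
  · exact hj _
  · rwa [show c (incidentEdge 6 i) = i from congrFun h i]

theorem signedSum_edgeList : signedSum edgeList (2 ^ (6 * 12) - 1) = 1 := by
  decide +kernel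

theorem sum_starSign_ne_zero : ∑ c : Fin 36 → Fin 6, ∏ v, starSign (c ∘ incidentEdge v) ≠ 0 := by
  rw [sum_starSign_eq_factorial_mul incidentEdge (by decide) 6]
  refine mul_ne_zero (by exact_mod_cast (Nat.factorial_ne_zero 6)) fun h => ?_
  have hsum := signedSum_eq_sum_starSign firstEnd secondEnd (by decide +kernel) colorMask
    incidentEdge incidentEdge_strictMono exists_incidentEdge_eq_iff 6 forall_colorMask_iff
  rw [← edgeList_eq_ofFn, signedSum_edgeList, h] at hsum
  exact absurd hsum (by decide)

/-- The edge of `G15'` with a given index. -/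
def edge (i : Fin 36) : Sym2 (Fin 12) := s(firstEnd i, secondEnd i)

theorem edge_injective : Function.Injective edge := by
  have h : ∀ i j, edge i = edge j → i = j := by decide +kernel
  exact fun i j => h i j

theorem mem_edgeSet_iff (e : Sym2 (Fin 12)) : e ∈ G15'.edgeSet ↔ ∃ i, edge i = e := by
  rw [G15', SimpleGraph.edgeSet_fromEdgeSet]
  simp only [Set.mem_sdiff, Set.mem_insert_iff, Set.mem_singleton_iff]
  revert e
  decide +kernel

theorem G15'_listEdgeColorable : ListEdgeColorable G15' 6 := by
  intro α L hL
  have hsub : ∀ i, ∃ x : Fin 6 ↪ α, ∀ k, x k ∈ L (edge i) := by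
    intro i
    obtain ⟨t, ht, hcard⟩ := Finset.exists_subset_card_eq (hL _ ((mem_edgeSet_iff _).2 ⟨i, rfl⟩))
    exact ⟨(t.equivFinOfCardEq hcard).symm.toEmbedding.trans (Function.Embedding.subtype _),
      fun k => ht ((t.equivFinOfCardEq hcard).symm k).2⟩
  choose x hx using hsub
  obtain ⟨c, hc⟩ := exists_forall_injective_of_sum_starSign_ne_zero incidentEdge
    card_incidentEdge_fiber sum_starSign_ne_zero (fun i => x i) fun i => (x i).injective
  have hinv := Function.leftInverse_invFun edge_injective
  refine ⟨fun e => x (Function.invFun edge e) (c (Function.invFun edge e)), ?_, ?_⟩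
  · intro e he
    obtain ⟨i, rfl⟩ := (mem_edgeSet_iff e).1 he
    simpa [hinv i] using hx i (c i)
  · rintro e₁ h₁ e₂ h₂ hne ⟨v, hv₁, hv₂⟩
    obtain ⟨i, rfl⟩ := (mem_edgeSet_iff e₁).1 h₁
    obtain ⟨j, rfl⟩ := (mem_edgeSet_iff e₂).1 h₂
    obtain ⟨a, rfl⟩ := (exists_incidentEdge_eq_iff v i).2 (Sym2.mem_iff.1 hv₁)
    obtain ⟨b, rfl⟩ := (exists_incidentEdge_eq_iff v j).2 (Sym2.mem_iff.1 hv₂)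
    simp only [hinv _]
    exact fun h => hne (congrArg (fun a => edge (incidentEdge v a)) (hc v h))
end

section
/- Let G₁₈ be the pentagonal bipyramid: the simple graph on vertex set {0,1,...,6} whose edges are the 5-cycle 1–2–3–4–5–1 together with all edges from vertex 0 to 1,2,3,4,5 and all edges from vertex 6 to 1,2,3,4,5. Then G₁₈ is 6-list-edge-colorable. -/
/-- The pentagonal bipyramid `G₁₈`. -/
def G18 : SimpleGraph (Fin 7) :=
  SimpleGraph.fromEdgeSet
    {s(0, 1), s(0, 2), s(0, 3), s(0, 4), s(0, 5), s(1, 2), s(1, 5), s(1, 6), s(2, 3), s(2, 6), s(3, 4), s(3, 6), s(4, 5), s(4, 6), s(5, 6)}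

theorem Finset.exists_mem_notMem_of_card_le {α : Type*} {k : ℕ} {L : Finset α}
    (hL : k + 1 ≤ L.card) (T : Finset α) (hT : T.card ≤ k) : ∃ x ∈ L, x ∉ T :=
  Finset.exists_mem_notMem_of_card_lt_card (by lia)

/-- A choice of one element from each of five lists, with cyclically consecutive choices
distinct. -/
def IsPentagonColoring {α : Type*} (M : Fin 5 → Finset α) (m : Fin 5 → α) : Prop :=
  ∀ i, m i ∈ M i ∧ m i ≠ m (i + 1)

theorem exists_isPentagonColoring_of_mem_of_notMem_one {α : Type*} {M : Fin 5 → Finset α}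
    (hM : ∀ i, 2 ≤ (M i).card) {x : α} (hx : x ∈ M 0) (hx' : x ∉ M 1) :
    ∃ m, IsPentagonColoring M m := by
  obtain ⟨x₄, h₄, h₄'⟩ := Finset.exists_mem_notMem_of_card_le (hM 4) {x} (by simp)
  obtain ⟨x₃, h₃, h₃'⟩ := Finset.exists_mem_notMem_of_card_le (hM 3) {x₄} (by simp)
  obtain ⟨x₂, h₂, h₂'⟩ := Finset.exists_mem_notMem_of_card_le (hM 2) {x₃} (by simp)
  obtain ⟨x₁, h₁, h₁'⟩ := Finset.exists_mem_notMem_of_card_le (hM 1) {x₂} (by simp)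
  have h : x ≠ x₁ := fun h => hx' (h ▸ h₁)
  refine ⟨![x, x₁, x₂, x₃, x₄], fun i => ?_⟩
  simp only [Finset.mem_singleton] at *
  fin_cases i
  exacts [⟨hx, h⟩, ⟨h₁, h₁'⟩, ⟨h₂, h₂'⟩, ⟨h₃, h₃'⟩, ⟨h₄, h₄'⟩]

theorem exists_isPentagonColoring_of_mem_of_notMem {α : Type*} {M : Fin 5 → Finset α}
    (hM : ∀ i, 2 ≤ (M i).card) {i : Fin 5} {x : α} (hx : x ∈ M i) (hx' : x ∉ M (i + 1)) :
    ∃ m, IsPentagonColoring M m := by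
  obtain ⟨m, hm⟩ := exists_isPentagonColoring_of_mem_of_notMem_one
    (M := fun j => M (i + j)) (fun j => hM _) (x := x) (by simpa using hx) hx'
  refine ⟨fun j => m (j - i), fun j => ?_⟩
  have h : m (j - i) ∈ M (i + (j - i)) ∧ m (j - i) ≠ m (j - i + 1) := hm (j - i)
  rwa [add_sub_cancel, sub_add_eq_add_sub] at h

theorem exists_isPentagonColoring_of_three_le_card {α : Type*} {M : Fin 5 → Finset α}
    (hM : ∀ i, 2 ≤ (M i).card) (hcard : 3 ≤ (M 0).card) :
    ∃ m, IsPentagonColoring M m := by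
  classical
  obtain ⟨x₄, h₄, -⟩ := Finset.exists_mem_notMem_of_card_le (hM 4) ∅ (by simp)
  obtain ⟨x₃, h₃, h₃'⟩ := Finset.exists_mem_notMem_of_card_le (hM 3) {x₄} (by simp)
  obtain ⟨x₂, h₂, h₂'⟩ := Finset.exists_mem_notMem_of_card_le (hM 2) {x₃} (by simp)
  obtain ⟨x₁, h₁, h₁'⟩ := Finset.exists_mem_notMem_of_card_le (hM 1) {x₂} (by simp)
  obtain ⟨x₀, h₀, hne₀⟩ := Finset.exists_mem_notMem_of_card_le hcard {x₁, x₄} Finset.card_le_two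
  simp only [Finset.mem_insert, Finset.mem_singleton, not_or] at *
  refine ⟨![x₀, x₁, x₂, x₃, x₄], fun i => ?_⟩
  fin_cases i
  exacts [⟨h₀, hne₀.1⟩, ⟨h₁, h₁'⟩, ⟨h₂, h₂'⟩, ⟨h₃, h₃'⟩, ⟨h₄, Ne.symm hne₀.2⟩]

/-- A pentagon with lists of size at least two that cannot be colored from its lists has all
its lists equal, of size two. -/
theorem eq_and_card_le_two_of_not_isPentagonColoring {α : Type*} {M : Fin 5 → Finset α}
    (hM : ∀ i, 2 ≤ (M i).card) (h : ¬ ∃ m, IsPentagonColoring M m) (i : Fin 5) :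
    M i = M 0 ∧ (M i).card ≤ 2 := by
  have hsub (i : Fin 5) : M i ⊆ M (i + 1) := fun x hx => by
    by_contra hx'
    exact h (exists_isPentagonColoring_of_mem_of_notMem hM hx hx')
  have h0 : (M 0).card ≤ 2 := by
    by_contra h0
    exact h (exists_isPentagonColoring_of_three_le_card hM (by lia))
  have h01 : M 0 ⊆ M 1 := hsub 0
  have h12 : M 1 ⊆ M 2 := hsub 1
  have h23 : M 2 ⊆ M 3 := hsub 2
  have h34 : M 3 ⊆ M 4 := hsub 3
  have h40 : M 4 ⊆ M 0 := hsub 4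
  have key : M i = M 0 := by
    apply Finset.Subset.antisymm <;> fin_cases i <;> intro x hx <;> simp at hx ⊢ <;> grind
  exact ⟨key, key ▸ h0⟩

/-- Colorings `a` and `b` of the edges joining two apices to the vertices of a pentagon, from
lists `P` and `Q`. -/
structure IsSpokeColoring {α : Type*} (P Q : Fin 5 → Finset α) (a b : Fin 5 → α) : Prop where
  left_mem : ∀ i, a i ∈ P i
  right_mem : ∀ i, b i ∈ Q i
  left_injective : Function.Injective a
  right_injective : Function.Injective b
  left_ne_right : ∀ i, a i ≠ b i

theorem exists_injective_mem_ne {α : Type*} {P : Fin 5 → Finset α} (hP : ∀ i, 6 ≤ (P i).card)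
    (d : Fin 5 → α) : ∃ a : Fin 5 → α, Function.Injective a ∧ ∀ i, a i ∈ P i ∧ a i ≠ d i := by
  classical
  have pick (i : Fin 5) (T : Finset α) (hT : T.card ≤ 5) : ∃ x ∈ P i, x ∉ T :=
    Finset.exists_mem_notMem_of_card_le (hP i) T hT
  obtain ⟨x₀, h₀, h₀'⟩ := pick 0 {d 0} (by simp)
  obtain ⟨x₁, h₁, h₁'⟩ := pick 1 {d 1, x₀} (Finset.card_le_two.trans (by lia))
  obtain ⟨x₂, h₂, h₂'⟩ := pick 2 {d 2, x₀, x₁} (Finset.card_le_three.trans (by lia))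
  obtain ⟨x₃, h₃, h₃'⟩ := pick 3 {d 3, x₀, x₁, x₂} (Finset.card_le_four.trans (by lia))
  obtain ⟨x₄, h₄, h₄'⟩ := pick 4 {d 4, x₀, x₁, x₂, x₃} Finset.card_le_five
  simp only [Finset.mem_insert, Finset.mem_singleton, not_or] at *
  refine ⟨![x₀, x₁, x₂, x₃, x₄], fun i j h => ?_, fun i => ?_⟩
  · fin_cases i <;> fin_cases j <;> simp at h ⊢ <;> grind
  · fin_cases i
    exacts [⟨h₀, h₀'⟩, ⟨h₁, h₁'.1⟩, ⟨h₂, h₂'.1⟩, ⟨h₃, h₃'.1⟩, ⟨h₄, h₄'.1⟩]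

theorem exists_isSpokeColoring {α : Type*} {P Q : Fin 5 → Finset α}
    (hP : ∀ i, 6 ≤ (P i).card) (hQ : ∀ i, 6 ≤ (Q i).card) :
    ∃ a b, IsSpokeColoring P Q a b := by
  obtain ⟨x, -⟩ : (P 0).Nonempty := Finset.card_pos.1 (by have := hP 0; lia)
  obtain ⟨a, ha, ha'⟩ := exists_injective_mem_ne hP fun _ => x
  obtain ⟨b, hb, hb'⟩ := exists_injective_mem_ne hQ a
  exact ⟨a, b, fun i => (ha' i).1, fun i => (hb' i).1, ha, hb, fun i => (hb' i).2.symm⟩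

open Classical in
/-- The colors still available on the edges of the pentagon once the spokes are colored. -/
noncomputable def rimResidue {α : Type*} (R : Fin 5 → Finset α) (a b : Fin 5 → α) (i : Fin 5) :
    Finset α :=
  R i \ {a i, b i, a (i + 1), b (i + 1)}

theorem mem_rimResidue {α : Type*} {R : Fin 5 → Finset α} {a b : Fin 5 → α} {i : Fin 5} {x : α} :
    x ∈ rimResidue R a b i ↔
      x ∈ R i ∧ x ≠ a i ∧ x ≠ b i ∧ x ≠ a (i + 1) ∧ x ≠ b (i + 1) := by
  simp [rimResidue]

theorem two_le_card_rimResidue {α : Type*} {R : Fin 5 → Finset α} (hR : ∀ i, 6 ≤ (R i).card)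
    (a b : Fin 5 → α) (i : Fin 5) : 2 ≤ (rimResidue R a b i).card := by
  classical
  have h₁ := Finset.le_card_sdiff {a i, b i, a (i + 1), b (i + 1)} (R i)
  have h₂ := Finset.card_le_four (a := a i) (b := b i) (c := a (i + 1)) (d := b (i + 1))
  have h₃ := hR i
  unfold rimResidue
  lia

theorem left_mem_and_ne_of_card_rimResidue_le {α : Type*} {R : Fin 5 → Finset α}
    (hR : ∀ i, 6 ≤ (R i).card) {a b : Fin 5 → α} {i : Fin 5}
    (h : (rimResidue R a b i).card ≤ 2) :
    a i ∈ R i ∧ a i ≠ b i ∧ a i ≠ a (i + 1) ∧ a i ≠ b (i + 1) := by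
  classical
  by_contra hc
  have hsub : R i \ {b i, a (i + 1), b (i + 1)} ⊆ rimResidue R a b i := by
    intro x hx
    rw [mem_rimResidue]
    simp only [Finset.mem_sdiff, Finset.mem_insert, Finset.mem_singleton, not_or] at hx
    grind
  have h₁ := Finset.le_card_sdiff {b i, a (i + 1), b (i + 1)} (R i)
  have h₂ := Finset.card_le_three (a := b i) (b := a (i + 1)) (c := b (i + 1))
  have h₃ := hR i
  have h₄ := Finset.card_le_card hsub
  lia

/-- If the pentagon cannot be completed, then it can be completed after recoloring
the spoke `i`, and possibly the spoke `i + 4`, at one apex. -/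
theorem exists_isPentagonColoring_of_recolor {α : Type*} {R : Fin 5 → Finset α}
    (hR : ∀ i, 6 ≤ (R i).card) {a a' b : Fin 5 → α}
    (h : ¬ ∃ m, IsPentagonColoring (rimResidue R a b) m) {i : Fin 5} (hi : a' i ≠ a i)
    (h₁ : a' (i + 1) = a (i + 1)) (h₂ : a' (i + 2) = a (i + 2))
    (h₃ : a' (i + 3) = a (i + 3)) : ∃ m, IsPentagonColoring (rimResidue R a' b) m := by
  by_contra h'
  have key := eq_and_card_le_two_of_not_isPentagonColoring (two_le_card_rimResidue hR a b) h
  have key' := eq_and_card_le_two_of_not_isPentagonColoring (two_le_card_rimResidue hR a' b) h'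
  obtain ⟨hmem, hb, ha₁, hb₁⟩ := left_mem_and_ne_of_card_rimResidue_le hR (key i).2
  have hin : a i ∈ rimResidue R a' b i :=
    mem_rimResidue.2 ⟨hmem, hi.symm, hb, h₁ ▸ ha₁, hb₁⟩
  have hsame : rimResidue R a' b (i + 2) = rimResidue R a b (i + 2) := by
    have : i + 2 + 1 = i + 3 := by rw [add_assoc]; rfl
    simp only [rimResidue, this, h₂, h₃]
  rw [(key' i).1, ← (key' (i + 2)).1, hsame, (key (i + 2)).1, ← (key i).1] at hin
  exact (mem_rimResidue.1 hin).2.1 rfl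

/-- If recoloring a single spoke never helps, the list of that spoke consists of the colors
of its neighbors and its own color, and all these are distinct. -/
theorem left_mem_and_right_ne_of_rigid {α : Type*} {P Q R : Fin 5 → Finset α}
    (hP : ∀ i, 6 ≤ (P i).card) (hR : ∀ i, 6 ≤ (R i).card) {a b : Fin 5 → α}
    (hab : IsSpokeColoring P Q a b)
    (h : ∀ a', IsSpokeColoring P Q a' b → ¬ ∃ m, IsPentagonColoring (rimResidue R a' b) m)
    (i j : Fin 5) : a j ∈ P i ∧ a j ≠ b i := by
  classical
  have hsub : P i ⊆ insert (b i) (Finset.univ.image a) := by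
    intro x hx
    by_contra hx'
    simp only [Finset.mem_insert, Finset.mem_image, Finset.mem_univ, true_and, not_or,
      not_exists] at hx'
    have hne (k : Fin 5) (hk : k ≠ 0) : Function.update a i x (i + k) = a (i + k) :=
      Function.update_of_ne (by simpa using hk) _ _
    refine h (Function.update a i x) ⟨fun k => ?_, hab.right_mem, fun k l hkl => ?_,
      hab.right_injective, fun k => ?_⟩
      (exists_isPentagonColoring_of_recolor hR (h a hab) (i := i) ?_ (hne 1 (by decide))
        (hne 2 (by decide)) (hne 3 (by decide)))
    · have := hab.left_mem k
      grind [Function.update_apply]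
    · have := @hab.left_injective k l
      grind [Function.update_apply]
    · have := hab.left_ne_right k
      grind [Function.update_apply]
    · simpa using fun hxa => hx'.2 i hxa.symm
  have hcard : (Finset.univ.image a).card = 5 := by
    rw [Finset.card_image_of_injective _ hab.left_injective, Finset.card_fin]
  have hle := Finset.card_le_card hsub
  have hge := hP i
  have hj : a j ∈ Finset.univ.image a := Finset.mem_image_of_mem a (Finset.mem_univ j)
  refine ⟨?_, fun hb => ?_⟩
  · rw [Finset.eq_of_subset_of_card_le hsub
      ((Finset.card_insert_le _ _).trans (by rw [hcard]; exact hge))]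
    exact Finset.mem_insert_of_mem hj
  · rw [Finset.insert_eq_of_mem (hb ▸ hj)] at hle
    lia

theorem exists_isSpokeColoring_and_isPentagonColoring {α : Type*} {P Q R : Fin 5 → Finset α}
    (hP : ∀ i, 6 ≤ (P i).card) (hQ : ∀ i, 6 ≤ (Q i).card) (hR : ∀ i, 6 ≤ (R i).card) :
    ∃ a b m, IsSpokeColoring P Q a b ∧ IsPentagonColoring (rimResidue R a b) m := by
  obtain ⟨a, b, hab⟩ := exists_isSpokeColoring hP hQ
  by_contra! hc
  have h (a') (ha' : IsSpokeColoring P Q a' b) :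
      ¬ ∃ m, IsPentagonColoring (rimResidue R a' b) m := fun ⟨m, hm⟩ => hc a' b m ha' hm
  have key := left_mem_and_right_ne_of_rigid hP hR hab h
  refine h (a ∘ Equiv.swap 0 4) ⟨fun i => (key i _).1, hab.right_mem,
    hab.left_injective.comp (Equiv.injective _), hab.right_injective, fun i => (key i _).2⟩
    (exists_isPentagonColoring_of_recolor hR (h a hab) (i := 0) ?_ ?_ ?_ ?_)
  · exact fun h => absurd (hab.left_injective h) (by decide)
  all_goals exact congrArg a (by decide)

/-- The edges of `G18`: the two families of spokes, then the rim. -/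
def G18Edge : Fin 5 ⊕ Fin 5 ⊕ Fin 5 → Sym2 (Fin 7)
  | .inl i => s(0, i.succ.castSucc)
  | .inr (.inl i) => s(6, i.succ.castSucc)
  | .inr (.inr i) => s(i.succ.castSucc, (i + 1).succ.castSucc)

theorem G18Edge_injective : Function.Injective G18Edge := by
  unfold Function.Injective
  decide

theorem mem_edgeSet_G18_iff {e : Sym2 (Fin 7)} : e ∈ G18.edgeSet ↔ ∃ k, G18Edge k = e := by
  rw [G18, SimpleGraph.edgeSet_fromEdgeSet]
  simp only [Set.mem_sdiff, Set.mem_insert_iff, Set.mem_singleton_iff]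
  revert e
  decide

theorem G18_listEdgeColorable : ListEdgeColorable G18 6 := by
  intro α L hL
  have hL' (k) : 6 ≤ (L (G18Edge k)).card := hL _ (mem_edgeSet_G18_iff.2 ⟨k, rfl⟩)
  obtain ⟨a, b, m, hab, hm⟩ := exists_isSpokeColoring_and_isPentagonColoring
    (fun i => hL' (.inl i)) (fun i => hL' (.inr (.inl i))) (fun i => hL' (.inr (.inr i)))
  have hm' (i) := mem_rimResidue.1 (hm i).1
  let d : Fin 5 ⊕ Fin 5 ⊕ Fin 5 → α := Sum.elim a (Sum.elim b m)
  have hd (k) : d (Function.invFun G18Edge (G18Edge k)) = d k := by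
    rw [Function.leftInverse_invFun G18Edge_injective k]
  have share_spokes : ∀ i j : Fin 5,
      (∃ v, v ∈ G18Edge (.inl i) ∧ v ∈ G18Edge (.inr (.inl j))) → i = j := by decide
  have share_left : ∀ i j : Fin 5,
      (∃ v, v ∈ G18Edge (.inl i) ∧ v ∈ G18Edge (.inr (.inr j))) → i = j ∨ i = j + 1 := by decide
  have share_right : ∀ i j : Fin 5,
      (∃ v, v ∈ G18Edge (.inr (.inl i)) ∧ v ∈ G18Edge (.inr (.inr j))) →
        i = j ∨ i = j + 1 := by decide
  have share_rim : ∀ i j : Fin 5,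
      (∃ v, v ∈ G18Edge (.inr (.inr i)) ∧ v ∈ G18Edge (.inr (.inr j))) →
        i = j ∨ i = j + 1 ∨ j = i + 1 := by decide
  refine ⟨fun e => d (Function.invFun G18Edge e), fun e he => ?_,
    fun e₁ he₁ e₂ he₂ hne hv => ?_⟩
  · obtain ⟨k, rfl⟩ := mem_edgeSet_G18_iff.1 he
    simp only [hd]
    rcases k with i | i | i
    exacts [hab.left_mem i, hab.right_mem i, (hm' i).1]
  · obtain ⟨k, rfl⟩ := mem_edgeSet_G18_iff.1 he₁
    obtain ⟨l, rfl⟩ := mem_edgeSet_G18_iff.1 he₂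
    have hkl : k ≠ l := fun h => hne (congrArg _ h)
    have hv' : ∃ v, v ∈ G18Edge l ∧ v ∈ G18Edge k := hv.imp fun v h => h.symm
    simp only [hd]
    rcases k with i | i | i <;> rcases l with j | j | j <;>
      simp only [d, Sum.elim_inl, Sum.elim_inr]
    · exact fun h => hkl (congrArg _ (hab.left_injective h))
    · exact share_spokes i j hv ▸ hab.left_ne_right i
    · rcases share_left i j hv with rfl | rfl
      exacts [(hm' _).2.1.symm, (hm' _).2.2.2.1.symm]
    · exact share_spokes j i hv' ▸ (hab.left_ne_right j).symm
    · exact fun h => hkl (congrArg (Sum.inr ∘ Sum.inl) (hab.right_injective h))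
    · rcases share_right i j hv with rfl | rfl
      exacts [(hm' _).2.2.1.symm, (hm' _).2.2.2.2.symm]
    · rcases share_left j i hv' with rfl | rfl
      exacts [(hm' _).2.1, (hm' _).2.2.2.1]
    · rcases share_right j i hv' with rfl | rfl
      exacts [(hm' _).2.2.1, (hm' _).2.2.2.2]
    · rcases share_rim i j hv with rfl | rfl | rfl
      exacts [absurd rfl hkl, (hm _).2.symm, (hm _).2]
end

section
/- Let G₁₇ be the simple graph on vertex set {0,1,...,7} whose edges are: the 5-cycle 1–2–3–4–5–1; all edges from vertex 0 to 1,2,3,4,5; edges from vertex 6 to 1,2,3,7; and edges from vertex 7 to 1,3,4,5. Then G₁₇ is 6-list-edge-colorable. -/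
/-- The triangulation `G₁₇`. -/
def G17 : SimpleGraph (Fin 8) :=
  SimpleGraph.fromEdgeSet
    {s(0, 1), s(0, 2), s(0, 3), s(0, 4), s(0, 5), s(1, 2), s(1, 5), s(1, 6), s(1, 7), s(2, 3), s(2, 6), s(3, 4), s(3, 6), s(3, 7), s(4, 5), s(4, 7), s(5, 7), s(6, 7)}

open MvPolynomial Equiv in
/-- A product of Vandermonde determinants in variables indexed by `κ`, expanded over families of
permutations. -/
theorem prod_det_vandermonde_X {ι κ : Type*} [Fintype ι] [DecidableEq ι] {d : ℕ}
    (inc : ι → Fin d → κ) :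
    ∏ v, (Matrix.vandermonde fun i => (X (inc v i) : MvPolynomial κ ℤ)).det =
      ∑ σ : ι → Perm (Fin d),
        monomial (∑ v, ∑ i, Finsupp.single (inc v i) (σ v i : ℕ)) (∏ v, (Perm.sign (σ v) : ℤ)) := by
  have hdet (v : ι) : (Matrix.vandermonde fun i => (X (inc v i) : MvPolynomial κ ℤ)).det =
      ∑ τ : Perm (Fin d),
        monomial (∑ i, Finsupp.single (inc v i) (τ i : ℕ)) (Perm.sign τ : ℤ) := by
    rw [← Matrix.det_transpose, Matrix.det_apply']
    refine Finset.sum_congr rfl fun τ _ => ?_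
    rw [← mul_one (Perm.sign τ : ℤ), ← C_mul_monomial, monomial_sum_one]
    simp [Matrix.vandermonde_apply, X_pow_eq_monomial]
  simp_rw [hdet, Finset.prod_univ_sum, Fintype.piFinset_univ]
  exact Finset.sum_congr rfl fun σ _ => (monomial_sum_prod ..).symm

open MvPolynomial Equiv in
/-- **Combinatorial Nullstellensatz for a family of all-different constraints.** The `v`-th
constraint asks for distinct values at `inc v 0, inc v 1, …`. If the family of identity
permutations is determined by the total exponent it gives to each variable, then values can be
chosen from any sets larger than these exponents. -/
theorem exists_mem_forall_injective {ι κ α : Type*} [Fintype ι] [Fintype κ] [DecidableEq κ]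
    {d : ℕ} (inc : ι → Fin d → κ)
    (huniq : ∀ σ : ι → Perm (Fin d),
      (∀ e, ∑ v, ∑ i, (if inc v i = e then (σ v i : ℕ) else 0) =
        ∑ v, ∑ i, if inc v i = e then (i : ℕ) else 0) → σ = 1)
    (S : κ → Finset α) (hS : ∀ e, ∑ v, ∑ i, (if inc v i = e then (i : ℕ) else 0) < (S e).card) :
    ∃ c : κ → α, (∀ e, c e ∈ S e) ∧ ∀ v, Function.Injective fun i => c (inc v i) := by
  classical
  obtain ⟨g, hg⟩ := Set.countable_iff_exists_injOn.1 (Finset.univ.biUnion S).countable_toSet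
  have hgS (e : κ) : Set.InjOn g (S e) :=
    hg.mono (Finset.coe_subset.2 (Finset.subset_biUnion_of_mem S (Finset.mem_univ e)))
  set f : MvPolynomial κ ℤ := ∏ v, (Matrix.vandermonde fun i => X (inc v i)).det with hf
  set t : κ →₀ ℕ := ∑ v, ∑ i, Finsupp.single (inc v i) (i : ℕ) with ht
  have hcoeff : f.coeff t ≠ 0 := by
    rw [hf, prod_det_vandermonde_X, coeff_sum, Finset.sum_eq_single 1]
    · simp [coeff_monomial, ht]
    · intro σ _ hσ
      rw [coeff_monomial, if_neg]
      intro h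
      refine hσ (huniq σ fun e => ?_)
      simpa [ht, Finsupp.finsetSum_apply, Finsupp.single_apply] using DFunLike.congr_fun h e
    · simp
  have hhom : f.IsHomogeneous (∑ v : ι, ∑ i : Fin d, ∑ _j ∈ Finset.Ioi i, 1) := by
    simp_rw [hf, Matrix.det_vandermonde]
    exact IsHomogeneous.prod _ _ _ fun v _ => IsHomogeneous.prod _ _ _ fun i _ =>
      IsHomogeneous.prod _ _ _ fun j _ => (isHomogeneous_X _ _).sub (isHomogeneous_X _ _)
  have hdeg : f.totalDegree = t.degree := by
    rw [hhom.totalDegree (by rintro h; simp [h] at hcoeff), Finsupp.degree_eq_weight_one]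
    exact (hhom hcoeff).symm
  obtain ⟨s, hsS, hs⟩ := combinatorial_nullstellensatz_exists_eval_nonzero f t hcoeff hdeg
    (fun e => (S e).image fun a => (g a : ℤ)) fun e => by
      rw [Finset.card_image_of_injOn fun a ha b hb hab => hgS e ha hb (Nat.cast_injective hab)]
      simpa [ht, Finsupp.finsetSum_apply, Finsupp.single_apply] using hS e
  choose c hcS hc using fun e => Finset.mem_image.1 (hsS e)
  refine ⟨c, hcS, fun v i j hij => ?_⟩
  have hv := (Finset.prod_ne_zero_iff.1 (by rwa [hf, map_prod] at hs)) v (Finset.mem_univ v)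
  rw [RingHom.map_det, RingHom.mapMatrix_apply] at hv
  have hvand : (Matrix.vandermonde fun i => (X (inc v i) : MvPolynomial κ ℤ)).map (eval s) =
      Matrix.vandermonde fun i => s (inc v i) := by
    ext; simp [Matrix.vandermonde_apply]
  rw [hvand, Matrix.det_vandermonde_ne_zero_iff] at hv
  exact hv (by simpa only [← hc] using congrArg (fun a => (g a : ℤ)) hij)

/-- The neighbours of each vertex of `G17`, listed by increasing exponent; at the vertices of
degree four the vertex itself is appended, which stands for a loop. -/
def G17Neighbor : Fin 8 → Fin 5 → Fin 8 :=
  ![![1, 2, 3, 4, 5], ![0, 2, 5, 7, 6], ![0, 3, 6, 1, 2], ![7, 2, 4, 0, 6],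
    ![3, 7, 0, 5, 4], ![7, 0, 4, 1, 5], ![1, 3, 2, 7, 6], ![3, 1, 6, 4, 5]]

theorem exists_G17Neighbor_eq {v w : Fin 8} (h : s(v, w) ∈ G17.edgeSet) :
    ∃ i, G17Neighbor v i = w := by
  rw [SimpleGraph.mem_edgeSet, G17, SimpleGraph.fromEdgeSet_adj] at h
  revert v w
  simp only [Set.mem_insert_iff, Set.mem_singleton_iff]
  decide

theorem G17_exponent_lt_six (e : Sym2 (Fin 8)) :
    ∑ v, ∑ i, (if s(v, G17Neighbor v i) = e then (i : ℕ) else 0) < 6 := by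
  revert e
  decide

theorem G17_exponent_unique (σ : Fin 8 → Equiv.Perm (Fin 5))
    (h : ∀ e, ∑ v, ∑ i, (if s(v, G17Neighbor v i) = e then (σ v i : ℕ) else 0) =
      ∑ v, ∑ i, if s(v, G17Neighbor v i) = e then (i : ℕ) else 0) : σ = 1 := by
  have fiber (e : Sym2 (Fin 8)) :
      ∑ p : Fin 8 × Fin 5 with s(p.1, G17Neighbor p.1 p.2) = e, (σ p.1 p.2 : ℕ) =
        ∑ p : Fin 8 × Fin 5 with s(p.1, G17Neighbor p.1 p.2) = e, (p.2 : ℕ) := by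
    simpa only [Finset.sum_filter, Fintype.sum_prod_type] using h e
  have loop (v : Fin 8) (hv : ({p | s(p.1, G17Neighbor p.1 p.2) = s(v, v)} :
      Finset (Fin 8 × Fin 5)) = {(v, 4)}) : ∀ k ∈ ({4} : Finset (Fin 5)), σ v k = k := by
    have := fiber s(v, v)
    rw [hv, Finset.sum_singleton, Finset.sum_singleton] at this
    simpa using Fin.ext this
  -- If the ranks already known at `u` and `v` leave one way to split the exponent of `uv`,
  -- then the ranks of `uv` at `u` and at `v` are known.
  have step {u v : Fin 8} {A B : Finset (Fin 5)} (hA : ∀ k ∈ A, σ u k = k)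
      (hB : ∀ k ∈ B, σ v k = k) (i j : Fin 5) (huv : u ≠ v ∧ i ∉ A ∧ j ∉ B)
      (hfib : ({p | s(p.1, G17Neighbor p.1 p.2) = s(u, v)} : Finset (Fin 8 × Fin 5)) =
        {(u, i), (v, j)})
      (hforce : ∀ a ∉ A, ∀ b ∉ B, (a + b : ℕ) = i + j → a = i ∧ b = j) :
      (∀ k ∈ insert i A, σ u k = k) ∧ ∀ k ∈ insert j B, σ v k = k := by
    have hsum := fiber s(u, v)
    have hpair : (u, i) ≠ (v, j) := fun h => huv.1 (congrArg Prod.fst h)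
    rw [hfib, Finset.sum_pair hpair, Finset.sum_pair hpair] at hsum
    have hi : σ u i ∉ A := fun hm => huv.2.1 ((σ u).injective (hA _ hm) ▸ hm)
    have hj : σ v j ∉ B := fun hm => huv.2.2 ((σ v).injective (hB _ hm) ▸ hm)
    obtain ⟨hui, hvj⟩ := hforce _ hi _ hj hsum
    exact ⟨(Finset.forall_mem_insert ..).2 ⟨hui, hA⟩, (Finset.forall_mem_insert ..).2 ⟨hvj, hB⟩⟩
  have start (v : Fin 8) : ∀ k ∈ (∅ : Finset (Fin 5)), σ v k = k := by simp
  have h0 := start 0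
  have h1 := start 1
  have h2 := loop 2 (by decide)
  have h3 := start 3
  have h4 := loop 4 (by decide)
  have h5 := loop 5 (by decide)
  have h6 := loop 6 (by decide)
  have h7 := start 7
  obtain ⟨h0, h1⟩ := step h0 h1 0 0 (by decide) (by decide) (by decide)
  obtain ⟨h3, h7⟩ := step h3 h7 0 0 (by decide) (by decide) (by decide)
  obtain ⟨h0, h2⟩ := step h0 h2 1 0 (by decide) (by decide) (by decide)
  obtain ⟨h2, h3⟩ := step h2 h3 1 1 (by decide) (by decide) (by decide)
  obtain ⟨h3, h4⟩ := step h3 h4 2 0 (by decide) (by decide) (by decide)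
  obtain ⟨h0, h3⟩ := step h0 h3 2 3 (by decide) (by decide) (by decide)
  obtain ⟨h3, h6⟩ := step h3 h6 4 1 (by decide) (by decide) (by decide)
  obtain ⟨h2, h6⟩ := step h2 h6 2 2 (by decide) (by decide) (by decide)
  obtain ⟨h1, h2⟩ := step h1 h2 1 3 (by decide) (by decide) (by decide)
  obtain ⟨h6, h7⟩ := step h6 h7 3 2 (by decide) (by decide) (by decide)
  obtain ⟨h1, h7⟩ := step h1 h7 3 1 (by decide) (by decide) (by decide)
  obtain ⟨h1, h6⟩ := step h1 h6 4 0 (by decide) (by decide) (by decide)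
  obtain ⟨h4, h7⟩ := step h4 h7 1 3 (by decide) (by decide) (by decide)
  obtain ⟨h0, h4⟩ := step h0 h4 3 2 (by decide) (by decide) (by decide)
  obtain ⟨h5, h7⟩ := step h5 h7 0 4 (by decide) (by decide) (by decide)
  obtain ⟨h1, h5⟩ := step h1 h5 2 3 (by decide) (by decide) (by decide)
  obtain ⟨h0, h5⟩ := step h0 h5 4 1 (by decide) (by decide) (by decide)
  obtain ⟨h4, h5⟩ := step h4 h5 3 2 (by decide) (by decide) (by decide)
  funext v
  ext1 k
  fin_cases v
  exacts [h0 k (by decide +revert), h1 k (by decide +revert), h2 k (by decide +revert),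
    h3 k (by decide +revert), h4 k (by decide +revert), h5 k (by decide +revert),
    h6 k (by decide +revert), h7 k (by decide +revert)]

theorem G17_listEdgeColorable : ListEdgeColorable G17 6 := by
  classical
  intro α L hL
  have hedge : s(0, 1) ∈ G17.edgeSet := by simp [G17]
  obtain ⟨c, hcS, hc⟩ := exists_mem_forall_injective (fun v i => s(v, G17Neighbor v i))
    G17_exponent_unique (fun e => if e ∈ G17.edgeSet then L e else L s(0, 1)) fun e => by
      refine (G17_exponent_lt_six e).trans_le ?_
      split_ifs with he
      exacts [hL e he, hL _ hedge]
  refine ⟨c, fun e he => by simpa only [if_pos he] using hcS e, ?_⟩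
  rintro e₁ he₁ e₂ he₂ hne ⟨v, ⟨a, rfl⟩, ⟨b, rfl⟩⟩ heq
  obtain ⟨i, rfl⟩ := exists_G17Neighbor_eq he₁
  obtain ⟨j, rfl⟩ := exists_G17Neighbor_eq he₂
  exact hne (by rw [hc v heq])
end

section
/- Let G₁₁ be the simple graph on vertex set {0,1,...,6} whose edges are: the triangle on {1,2,3}; the triangle on {4,5,6}; edges from vertex 0 to 1,2,3; and the edges 1–4, 1–5, 2–5, 2–6, 3–6, 3–4. Then G₁₁ is 6-list-edge-colorable. -/
/-- The triangulation `G₁₁`. -/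
def G11 : SimpleGraph (Fin 7) :=
  SimpleGraph.fromEdgeSet
    {s(0, 1), s(0, 2), s(0, 3), s(1, 2), s(1, 3), s(1, 4), s(1, 5), s(2, 3), s(2, 5), s(2, 6), s(3, 4), s(3, 6), s(4, 5), s(4, 6), s(5, 6)}

/-- A kernel of `S` for the relation `r`: an independent subset `K` of `S` such that every other
element of `S` is related to by some element of `K`. -/
def IsKernel {ι : Type} (r : ι → ι → Prop) (S K : Finset ι) : Prop :=
  K ⊆ S ∧ (∀ i ∈ K, ∀ j ∈ K, ¬ r i j) ∧ ∀ j ∈ S, j ∉ K → ∃ i ∈ K, r i j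

/-- Every subset of `T` has a kernel for `r`. -/
def KernelPerfectOn {ι : Type} (r : ι → ι → Prop) (T : Finset ι) : Prop :=
  ∀ S ⊆ T, ∃ K, IsKernel r S K

/-- Adding an element that nothing in `T` is related to preserves kernel-perfectness. -/
theorem KernelPerfectOn.insert {ι : Type} [DecidableEq ι] {r : ι → ι → Prop} {T : Finset ι}
    (hT : KernelPerfectOn r T) {e : ι} (he : ¬ r e e) (heT : ∀ i ∈ T, ¬ r i e) :
    KernelPerfectOn r (insert e T) := by
  classical
  intro S hS
  by_cases heS : e ∈ S
  · obtain ⟨K, hKS, hind, hdom⟩ := hT {i ∈ S | i ≠ e ∧ ¬ r e i} (by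
      intro i hi
      have := @hS i
      simp_all)
    have hK : ∀ i ∈ K, i ∈ S ∧ i ≠ e ∧ ¬ r e i := fun i hi => by simpa using hKS hi
    have hKT : ∀ i ∈ K, i ∈ T := fun i hi =>
      Finset.mem_of_mem_insert_of_ne (hS (hK i hi).1) (hK i hi).2.1
    refine ⟨Insert.insert e K, ?_, ?_, ?_⟩
    · exact Finset.insert_subset heS fun i hi => (hK i hi).1
    · simp only [Finset.mem_insert]
      rintro i (rfl | hi) j (rfl | hj)
      · exact he
      · exact (hK j hj).2.2
      · exact heT i (hKT i hi)
      · exact hind i hi j hj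
    · intro j hj hjK
      rw [Finset.mem_insert, not_or] at hjK
      by_cases hej : r e j
      · exact ⟨e, Finset.mem_insert_self e K, hej⟩
      · obtain ⟨i, hi, hij⟩ := hdom j (by simp [hj, hjK.1, hej]) hjK.2
        exact ⟨i, Finset.mem_insert_of_mem hi, hij⟩
  · exact hT S ((Finset.subset_insert_iff_of_notMem heS).1 hS)

/-- The lemma of Bondy, Boppana and Siegel: if every subset of `T` has a kernel and every list is
longer than the number of elements of `T` related to its owner, then `T` can be properly colored
from the lists. -/
theorem KernelPerfectOn.exists_coloring {ι α : Type} {r : ι → ι → Prop} [DecidableRel r]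
    {T : Finset ι} [Nonempty α] (hT : KernelPerfectOn r T) (L : ι → Finset α)
    (hL : ∀ i ∈ T, {j ∈ T | r j i}.card < (L i).card) :
    ∃ c : ι → α, (∀ i ∈ T, c i ∈ L i) ∧ ∀ i ∈ T, ∀ j ∈ T, r i j → c i ≠ c j := by
  classical
  induction T using Finset.strongInduction generalizing L with
  | H T ih =>
  rcases T.eq_empty_or_nonempty with rfl | ⟨i₀, hi₀⟩
  · exact ⟨fun _ => Classical.arbitrary α, by simp⟩
  obtain ⟨a, ha⟩ : (L i₀).Nonempty := Finset.card_pos.1 (Nat.zero_lt_of_lt (hL i₀ hi₀))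
  obtain ⟨K, hKS, hind, hdom⟩ := hT {i ∈ T | a ∈ L i} (Finset.filter_subset _ _)
  have hK : ∀ i ∈ K, i ∈ T ∧ a ∈ L i := fun i hi => by simpa using hKS hi
  have hKne : K.Nonempty := by
    by_contra hne
    obtain rfl := Finset.not_nonempty_iff_eq_empty.1 hne
    simpa using hdom i₀ (by simp [hi₀, ha])
  have hlt : T \ K ⊂ T := Finset.sdiff_ssubset (fun i hi => (hK i hi).1) hKne
  obtain ⟨c, hcL, hc⟩ := ih (T \ K) hlt (fun S hS => hT S (hS.trans hlt.subset))
    (fun i => (L i).erase a) (by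
      intro i hi
      obtain ⟨hiT, hiK⟩ := Finset.mem_sdiff.1 hi
      have hsub : {j ∈ T \ K | r j i} ⊆ {j ∈ T | r j i} :=
        Finset.filter_subset_filter _ hlt.subset
      by_cases hai : a ∈ L i
      · obtain ⟨k, hkK, hki⟩ := hdom i (by simp [hiT, hai]) hiK
        have hcard : {j ∈ T \ K | r j i}.card < {j ∈ T | r j i}.card := by
          refine Finset.card_lt_card ((Finset.ssubset_iff_of_subset hsub).2 ⟨k, ?_, ?_⟩)
          · simp [(hK k hkK).1, hki]
          · simp [hkK]
        have := hL i hiT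
        rw [Finset.card_erase_of_mem hai]
        omega
      · rw [Finset.erase_eq_of_notMem hai]
        exact (Finset.card_le_card hsub).trans_lt (hL i hiT))
  have hca : ∀ i ∈ T, i ∉ K → c i ∈ L i ∧ c i ≠ a := fun i hi hiK => by
    have := hcL i (Finset.mem_sdiff.2 ⟨hi, hiK⟩)
    rw [Finset.mem_erase] at this
    exact this.symm
  refine ⟨fun i => if i ∈ K then a else c i, fun i hi => ?_, fun i hi j hj hij => ?_⟩
  · by_cases hiK : i ∈ K
    · simpa [hiK] using (hK i hiK).2
    · simpa [hiK] using (hca i hi hiK).1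
  · by_cases hiK : i ∈ K <;> by_cases hjK : j ∈ K
    · exact absurd hij (hind i hiK j hjK)
    · simpa [hiK, hjK] using (hca j hj hjK).2.symm
    · simpa [hiK, hjK] using (hca i hi hiK).2
    · simpa [hiK, hjK] using
        hc i (Finset.mem_sdiff.2 ⟨hi, hiK⟩) j (Finset.mem_sdiff.2 ⟨hj, hjK⟩) hij

/-- The edges of `G₁₁`, listed so that the last seven form a six-cycle with a long chord. -/
def G11Edge : Fin 15 → Sym2 (Fin 7) :=
  ![s(0, 1), s(1, 2), s(1, 3), s(2, 3), s(1, 4), s(3, 4), s(1, 5), s(5, 6),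
    s(0, 3), s(4, 5), s(2, 5), s(0, 2), s(2, 6), s(3, 6), s(4, 6)]

/-- The orientation of the line graph of `G₁₁` from earlier to later edges, except that
`s(3, 6)` precedes `s(0, 3)` and `s(4, 6)` precedes `s(4, 5)`. -/
def G11Precedes (i j : Fin 15) : Prop :=
  (∃ v, v ∈ G11Edge i ∧ v ∈ G11Edge j) ∧
    (i < j ∧ (i, j) ≠ (8, 13) ∧ (i, j) ≠ (9, 14) ∨ (i, j) = (13, 8) ∨ (i, j) = (14, 9))

instance : DecidableRel G11Precedes := fun i j => by
  unfold G11Precedes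
  infer_instance

theorem G11Edge_injective : Function.Injective G11Edge := by
  decide +kernel

theorem exists_G11Edge_eq {e : Sym2 (Fin 7)} (he : e ∈ G11.edgeSet) : ∃ i, G11Edge i = e := by
  revert he
  simp only [G11, SimpleGraph.edgeSet_fromEdgeSet, Set.mem_sdiff, Set.mem_insert_iff,
    Set.mem_singleton_iff]
  revert e
  decide +kernel

theorem G11Edge_mem_edgeSet (i : Fin 15) : G11Edge i ∈ G11.edgeSet := by
  simp only [G11, SimpleGraph.edgeSet_fromEdgeSet, Set.mem_sdiff, Set.mem_insert_iff,
    Set.mem_singleton_iff]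
  revert i
  decide +kernel

theorem G11Precedes_or_of_mem {i j : Fin 15} (hij : i ≠ j)
    (h : ∃ v, v ∈ G11Edge i ∧ v ∈ G11Edge j) : G11Precedes i j ∨ G11Precedes j i := by
  revert i j
  decide +kernel

set_option synthInstance.maxSize 2000 in
theorem kernelPerfectOn_G11Precedes : KernelPerfectOn G11Precedes Finset.univ := by
  have hcore : KernelPerfectOn G11Precedes {8, 9, 10, 11, 12, 13, 14} := by
    have h : ∀ S ∈ [8, 9, 10, 11, 12, 13, 14].sublists, ∃ K ∈ S.sublists,
        (∀ i ∈ K, ∀ j ∈ K, ¬ G11Precedes i j) ∧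
          ∀ j ∈ S, j ∉ K → ∃ i ∈ K, G11Precedes i j := by
      decide +kernel
    intro S hS
    obtain ⟨K, hKS, hind, hdom⟩ := h ([8, 9, 10, 11, 12, 13, 14].filter (· ∈ S))
      (List.mem_sublists.2 List.filter_sublist)
    have hmem : ∀ i, i ∈ [8, 9, 10, 11, 12, 13, 14].filter (· ∈ S) ↔ i ∈ S := fun i => by
      have := @hS i
      simp only [Finset.mem_insert, Finset.mem_singleton] at this
      simpa using this
    refine ⟨K.toFinset, fun i hi => ?_, by simpa using hind, fun j hj hjK => ?_⟩
    · exact (hmem i).1 ((List.mem_sublists.1 hKS).subset (List.mem_toFinset.1 hi))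
    · simpa using hdom j ((hmem j).2 hj) (by simpa using hjK)
  have huniv : (Finset.univ : Finset (Fin 15)) = insert 0 (insert 1 (insert 2 (insert 3
      (insert 4 (insert 5 (insert 6 (insert 7 {8, 9, 10, 11, 12, 13, 14}))))))) := by
    decide +kernel
  rw [huniv]
  iterate 8 refine KernelPerfectOn.insert ?_ (by decide +kernel) (by decide +kernel)
  exact hcore

theorem G11_listEdgeColorable : ListEdgeColorable G11 6 := by
  intro α L hL
  have hcard : ∀ i, {j ∈ (Finset.univ : Finset (Fin 15)) | G11Precedes j i}.card < 6 := by
    decide +kernel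
  have : Nonempty α := by
    have h := hL _ (G11Edge_mem_edgeSet 0)
    obtain ⟨a, -⟩ := Finset.card_pos.1 (Nat.lt_of_lt_of_le (by decide) h)
    exact ⟨a⟩
  obtain ⟨c, hcL, hc⟩ := kernelPerfectOn_G11Precedes.exists_coloring (fun i => L (G11Edge i))
    fun i _ => (hcard i).trans_le (hL _ (G11Edge_mem_edgeSet i))
  have hinv := Function.leftInverse_invFun G11Edge_injective
  refine ⟨c ∘ Function.invFun G11Edge, fun e he => ?_, fun e₁ he₁ e₂ he₂ hne hv => ?_⟩
  · obtain ⟨i, rfl⟩ := exists_G11Edge_eq he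
    simpa [hinv i] using hcL i (Finset.mem_univ i)
  · obtain ⟨i, rfl⟩ := exists_G11Edge_eq he₁
    obtain ⟨j, rfl⟩ := exists_G11Edge_eq he₂
    simp only [Function.comp_apply, hinv i, hinv j]
    rcases G11Precedes_or_of_mem (ne_of_apply_ne _ hne) hv with h | h
    · exact hc i (Finset.mem_univ i) j (Finset.mem_univ j) h
    · exact (hc j (Finset.mem_univ j) i (Finset.mem_univ i) h).symm
end
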